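/- arXiv:math/0107086 — 3 statements merged into one kernel-verified Lean document; each statement's English description precedes it below -/
import Mathlib

section
/- Let M be a locally compact Hausdorff topological space and let (F_t)_{t \ge 0} be a semiflow on M whose trajectories are continuous. Let m \in M and let f : M \to \mathbb{R} be a continuous function such that f(m) = 0, f(x) > 0 for all x \ne m in some neighborhood of m, and such that for every \varepsilon > 0 there exists an open neighborhood V_\varepsilon of m with 0 \le f(F_t(v)) < \varepsilon for all v \in V_\varepsilon and all t \ge 0. Then m is Liapunov stable: for every open neighborhood U of m there exists an open neighborhood V of m such that F_t(V) \subseteq U for all t \ge 0. -/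
/-- **Liapunov stability test (trivial symmetry group).**
Let `M` be a locally compact Hausdorff space and `F` a semiflow on `M` with
continuous trajectories.  If `f : M → ℝ` is continuous, vanishes at `m`, is
positive near `m` away from `m`, and for every `ε > 0` there is an open
neighborhood `V_ε` of `m` whose forward trajectories keep `f` in `[0, ε)`,
then `m` is Liapunov stable. -/
theorem liapunov_stability_test
    {M : Type*} [TopologicalSpace M] [LocallyCompactSpace M] [T2Space M]
    (F : ℝ → M → M)
    (hF0 : F 0 = id)
    (hFadd : ∀ t s : ℝ, 0 ≤ t → 0 ≤ s → F (t + s) = F t ∘ F s)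
    (htraj : ∀ x : M, ContinuousOn (fun t => F t x) (Set.Ici (0 : ℝ)))
    (m : M) (f : M → ℝ) (hf : Continuous f) (hfm : f m = 0)
    (hpos : ∃ N ∈ nhds m, ∀ x ∈ N, x ≠ m → 0 < f x)
    (hLS3 : ∀ ε : ℝ, 0 < ε → ∃ V : Set M, IsOpen V ∧ m ∈ V ∧
      ∀ v ∈ V, ∀ t : ℝ, 0 ≤ t → 0 ≤ f (F t v) ∧ f (F t v) < ε) :
    ∀ U : Set M, IsOpen U → m ∈ U →
      ∃ V : Set M, IsOpen V ∧ m ∈ V ∧ ∀ v ∈ V, ∀ t : ℝ, 0 ≤ t → F t v ∈ U := by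
  intro U hU hmU
  obtain ⟨N, hN, hNpos⟩ := hpos
  obtain ⟨K, hK, hKs, hKc⟩ := local_compact_nhds (Filter.inter_mem hN (hU.mem_nhds hmU))
  have hmK : m ∈ interior K := mem_interior_iff_mem_nhds.2 hK
  have hfrK : frontier K ⊆ K := hKc.isClosed.frontier_subset
  have hfc : IsCompact (frontier K) := hKc.of_isClosed_subset isClosed_frontier hfrK
  obtain ⟨ε, hε, hεle⟩ := hfc.exists_forall_le' (f := f) (a := 0) hf.continuousOn (by
    intro x hx
    refine hNpos x (hKs (hfrK hx)).1 ?_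
    rintro rfl
    exact hx.2 hmK)
  obtain ⟨V, hVo, hmV, hV⟩ := hLS3 ε hε
  refine ⟨V ∩ interior K, hVo.inter isOpen_interior, ⟨hmV, hmK⟩, ?_⟩
  rintro v ⟨hvV, hvK⟩ t ht
  have hpre : IsPreconnected ((fun t => F t v) '' Set.Ici (0 : ℝ)) :=
    isPreconnected_Ici.image _ (htraj v)
  have hsub : ((fun t => F t v) '' Set.Ici (0 : ℝ)) ⊆ interior K := by
    refine hpre.subset_left_of_subset_union isOpen_interior hKc.isClosed.isOpen_compl
      (disjoint_compl_right.mono_left interior_subset) ?_ ?_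
    · rintro _ ⟨s, hs, rfl⟩
      by_contra hcon
      rw [Set.mem_union, not_or, Set.mem_compl_iff, not_not] at hcon
      exact absurd (hεle _ ⟨subset_closure hcon.2, hcon.1⟩) (not_le.2 (hV v hvV s hs).2)
    · exact ⟨v, ⟨0, Set.mem_Ici.2 le_rfl, by simp [hF0]⟩, hvK⟩
  exact (hKs (interior_subset (hsub ⟨t, ht, rfl⟩))).2
end

section
/- Let M be a locally compact Hausdorff topological space, K \subseteq M a compact subset, and f : M \to \mathbb{R} a continuous function such that f = 0 on K and f(x) > 0 for all x \in N \setminus K, where N is some open neighborhood of K. Then for every open set U with K \subseteq U there exist a compact set L with K contained in the interior of L and L \subseteq U, and a real number \varepsilon > 0, such that f(x) \ge \varepsilon for every point x in the topological frontier of L. -/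
/-- **Compactness lemma for Liapunov functions vanishing on a compact set.**
Let `M` be locally compact Hausdorff, `K ⊆ M` compact, and `f : M → ℝ`
continuous with `f = 0` on `K` and `f > 0` on `N \ K` for some open
neighborhood `N` of `K`.  Then for every open `U ⊇ K` there is a compact `L`
with `K ⊆ interior L`, `L ⊆ U`, and an `ε > 0` with `f ≥ ε` on the frontier
of `L`. -/
theorem liapunov_frontier_bound
    {M : Type*} [TopologicalSpace M] [LocallyCompactSpace M] [T2Space M]
    (K : Set M) (hK : IsCompact K)
    (f : M → ℝ) (hf : Continuous f) (hfK : ∀ x ∈ K, f x = 0)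
    (hpos : ∃ N : Set M, IsOpen N ∧ K ⊆ N ∧ ∀ x ∈ N \ K, 0 < f x) :
    ∀ U : Set M, IsOpen U → K ⊆ U →
      ∃ L : Set M, IsCompact L ∧ K ⊆ interior L ∧ L ⊆ U ∧
        ∃ ε : ℝ, 0 < ε ∧ ∀ x ∈ frontier L, ε ≤ f x := by
  obtain ⟨N, hN, hKN, hNpos⟩ := hpos
  intro U hU hKU
  obtain ⟨L, hL, hKL, hLU⟩ := exists_compact_between hK (hU.inter hN)
    (Set.subset_inter hKU hKN)
  refine ⟨L, hL, hKL, fun x hx => (hLU hx).1, ?_⟩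
  have hfr : IsCompact (frontier L) :=
    hL.of_isClosed_subset isClosed_frontier hL.isClosed.frontier_subset
  rcases (frontier L).eq_empty_or_nonempty with h | h
  · exact ⟨1, one_pos, by simp [h]⟩
  · obtain ⟨x, hx, hmin⟩ := hfr.exists_isMinOn h hf.continuousOn
    refine ⟨f x, hNpos x ⟨(hLU (hL.isClosed.frontier_subset hx)).2, fun hxK => ?_⟩,
      fun y hy => hmin hy⟩
    exact hx.2 (hKL hxK)
end

section
/- Let V be a finite-dimensional real vector space, and let Q_1 and Q_2 be symmetric bilinear forms on V such that Q_2 is positive semidefinite with null space K = \{v \in V : Q_2(v, v) = 0\}, and such that Q_1 is positive definite on K (i.e., Q_1(v, v) > 0 for every nonzero v \in K). Then there exists \sigma_0 \in \mathbb{R} such that for every \sigma \ge \sigma_0 the symmetric bilinear form Q_1 + \sigma Q_2 is positive definite on all of V. -/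
/-- Compactness step: penalization of continuous functions on a compact set. -/
theorem penalization_compact {X : Type*} [TopologicalSpace X] {S : Set X} (hS : IsCompact S)
    {f g : X → ℝ} (hf : Continuous f) (hg : Continuous g) (hg0 : ∀ x, 0 ≤ g x)
    (h : ∀ x ∈ S, g x = 0 → 0 < f x) :
    ∃ s₀ : ℝ, ∀ s : ℝ, s₀ ≤ s → ∀ x ∈ S, 0 < f x + s * g x := by
  have hC : IsCompact (S ∩ {x | f x ≤ 0}) :=
    hS.inter_right (isClosed_le hf continuous_const)
  rcases (S ∩ {x | f x ≤ 0}).eq_empty_or_nonempty with he | hne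
  · refine ⟨0, fun s hs x hx => ?_⟩
    have h1 : 0 < f x := by
      by_contra hcon
      have : x ∈ S ∩ {x | f x ≤ 0} := ⟨hx, not_lt.mp hcon⟩
      rw [he] at this
      exact this
    have := mul_nonneg hs (hg0 x)
    linarith
  · obtain ⟨a, ha, hamin⟩ := hC.exists_isMinOn hne hg.continuousOn
    obtain ⟨b, hb, hbmin⟩ := hC.exists_isMinOn hne hf.continuousOn
    have hm : 0 < g a := by
      refine lt_of_le_of_ne (hg0 a) fun h0 => ?_
      have h1 := h a ha.1 h0.symm
      have h2 : f a ≤ 0 := ha.2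
      linarith
    refine ⟨max 0 ((1 - f b) / g a), fun s hs x hx => ?_⟩
    have hs0 : 0 ≤ s := (le_max_left _ _).trans hs
    have hs1 : (1 - f b) / g a ≤ s := (le_max_right _ _).trans hs
    rw [div_le_iff₀ hm] at hs1
    by_cases hx0 : f x ≤ 0
    · have h1 : g a ≤ g x := hamin ⟨hx, hx0⟩
      have h2 : f b ≤ f x := hbmin ⟨hx, hx0⟩
      have := mul_le_mul_of_nonneg_left h1 hs0
      linarith
    · have := mul_nonneg hs0 (hg0 x)
      linarith [not_le.mp hx0]

/-- **Penalization lemma.**  Let `V` be a finite-dimensional real vector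
space, `Q₁`, `Q₂` symmetric bilinear forms with `Q₂` positive semidefinite
with null space `K = {v | Q₂ v v = 0}`, and `Q₁` positive definite on `K`.
Then `Q₁ + σ Q₂` is positive definite on all of `V` for all sufficiently
large `σ`. -/
theorem penalization_positive_definite
    {V : Type*} [AddCommGroup V] [Module ℝ V] [FiniteDimensional ℝ V]
    (Q₁ Q₂ : V →ₗ[ℝ] V →ₗ[ℝ] ℝ)
    (hQ₁symm : ∀ v w : V, Q₁ v w = Q₁ w v)
    (hQ₂symm : ∀ v w : V, Q₂ v w = Q₂ w v)
    (hQ₂pos : ∀ v : V, 0 ≤ Q₂ v v)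
    (hQ₁posK : ∀ v : V, Q₂ v v = 0 → v ≠ 0 → 0 < Q₁ v v) :
    ∃ σ₀ : ℝ, ∀ σ : ℝ, σ₀ ≤ σ → ∀ v : V, v ≠ 0 → 0 < Q₁ v v + σ * Q₂ v v := by
  let E := EuclideanSpace ℝ (Fin (Module.finrank ℝ V))
  let e : E ≃ₗ[ℝ] V := LinearEquiv.ofFinrankEq E V (by simp [E])
  have hcont : ∀ Q : V →ₗ[ℝ] V →ₗ[ℝ] ℝ, Continuous fun x : E => Q (e x) (e x) := by
    intro Q
    let b := Module.finBasis ℝ V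
    have hrepr : ∀ i, Continuous fun x : E => b.repr (e x) i := fun i =>
      LinearMap.continuous_of_finiteDimensional ((b.coord i).comp e.toLinearMap)
    have hsum : (fun x : E => Q (e x) (e x)) =
        fun x : E => ∑ i, b.repr (e x) i * Q (b i) (e x) := by
      funext x
      have h1 : Q (e x) = ∑ i, b.repr (e x) i • Q (b i) := by
        conv_lhs => rw [← b.sum_repr (e x)]
        simp only [map_sum, map_smul]
      rw [h1, LinearMap.sum_apply]
      simp only [LinearMap.smul_apply, smul_eq_mul]
    rw [hsum]
    refine continuous_finsetSum _ fun i _ => (hrepr i).mul ?_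
    exact LinearMap.continuous_of_finiteDimensional ((Q (b i)).comp e.toLinearMap)
  obtain ⟨s₀, hs₀⟩ := penalization_compact (isCompact_sphere (0 : E) 1) (hcont Q₁) (hcont Q₂)
    (fun x => hQ₂pos _) (fun x hx h0 => hQ₁posK _ h0 (by
      intro h1
      have h2 : x = 0 := by simpa using h1
      simp [h2] at hx))
  refine ⟨s₀, fun s hs v hv => ?_⟩
  have hx : e.symm v ≠ 0 := by simpa using hv
  have hn : 0 < ‖e.symm v‖ := norm_pos_iff.mpr hx
  have key := hs₀ s hs (‖e.symm v‖⁻¹ • e.symm v) (by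
    rw [mem_sphere_zero_iff_norm, norm_smul, norm_inv, norm_norm]
    exact inv_mul_cancel₀ hn.ne')
  simp only [map_smul, LinearEquiv.apply_symm_apply, LinearMap.smul_apply, smul_eq_mul] at key
  have hi : 0 < ‖e.symm v‖⁻¹ := inv_pos.mpr hn
  have h3 : 0 < (‖e.symm v‖⁻¹ * ‖e.symm v‖⁻¹) * (Q₁ v v + s * Q₂ v v) := by
    linarith
  exact (mul_pos_iff_of_pos_left (mul_pos hi hi)).mp h3
end
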